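/- Let μ be the uniform probability measure on D (Lebesgue measure restricted to D, normalized to total mass 1). Then the pushforward of μ under the map (x,y) ↦ √(y² + x^{−2}) is absolutely continuous with respect to Lebesgue measure with density g(s) = (12/(πs)) · ( √(s⁴ − 1) · 𝟙_{1 < s < (4/3)^{1/4}} + √(2s²(s² − √(s⁴ − 1)) − 1) · 𝟙_{s > (4/3)^{1/4}} ), and g(s) = 0 otherwise. In particular, the length of the second shortest basis vector of a random unimodular lattice in dimension 2 has this probability density function. -/

import Mathlib

open MeasureTheory Real

/-- The region `D = {(x,y) : x > 0, |y| ≤ x/2, and if x > 1 then y² ≥ x² - x⁻²}`,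
parametrizing a fundamental domain for `SL₂(ℝ)/SL₂^±(ℤ)`. -/
def Dset : Set (ℝ × ℝ) :=
  {p | 0 < p.1 ∧ |p.2| ≤ p.1 / 2 ∧ (1 < p.1 → p.1 ^ 2 - (p.1 ^ 2)⁻¹ ≤ p.2 ^ 2)}

/-- The uniform probability measure on `D`. -/
noncomputable def μD : Measure (ℝ × ℝ) := (volume Dset)⁻¹ • volume.restrict Dset

theorem lintegral_ofReal_deriv_eq_volume_image {s : Set ℝ} {f f' : ℝ → ℝ}
    (hs : MeasurableSet s) (hf : ∀ x ∈ s, HasDerivAt f (f' x) x)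
    (hf' : ∀ x ∈ s, 0 ≤ f' x) (hinj : Set.InjOn f s) :
    ∫⁻ x in s, ENNReal.ofReal (f' x) = volume (f '' s) := by
  have h := lintegral_image_eq_lintegral_abs_deriv_mul hs
    (fun x hx => (hf x hx).hasDerivWithinAt) hinj 1
  simp only [Pi.one_apply, mul_one, setLIntegral_one] at h
  rw [h]
  exact setLIntegral_congr_fun hs fun x hx => by simp only [abs_of_nonneg (hf' x hx)]

theorem mem_Dset_iff {x y : ℝ} :
    (x, y) ∈ Dset ↔ 0 < x ∧ |y| ≤ x / 2 ∧ x ^ 2 - (x ^ 2)⁻¹ ≤ y ^ 2 := by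
  simp only [Dset, Set.mem_ofPred_eq]
  refine ⟨fun ⟨h0, h1, h2⟩ => ⟨h0, h1, ?_⟩, fun ⟨h0, h1, h2⟩ => ⟨h0, h1, fun _ => h2⟩⟩
  rcases lt_or_ge 1 x with h | h
  · exact h2 h
  · have h3 : x ^ 2 ≤ 1 := pow_le_one₀ h0.le h
    have h4 : 1 ≤ (x ^ 2)⁻¹ := (one_le_inv₀ (by positivity)).2 h3
    nlinarith [sq_nonneg y]

theorem measurableSet_Dset : MeasurableSet Dset := by
  have : Dset = {p : ℝ × ℝ | 0 < p.1} ∩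
      ({p | |p.2| ≤ p.1 / 2} ∩ {p | p.1 ^ 2 - (p.1 ^ 2)⁻¹ ≤ p.2 ^ 2}) := by
    ext ⟨x, y⟩
    exact mem_Dset_iff
  rw [this]
  exact (measurableSet_lt (by fun_prop) (by fun_prop)).inter
    ((measurableSet_le (by fun_prop) (by fun_prop)).inter
      (measurableSet_le (by fun_prop) (by fun_prop)))

/-- The region `Dset` in the coordinates `x` and `u = y / x`. -/
def slopeRegion : Set (ℝ × ℝ) :=
  {p | 0 < p.1 ∧ |p.2| ≤ 1 / 2 ∧ p.1 ^ 4 * (1 - p.2 ^ 2) ≤ 1}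

theorem measurableSet_slopeRegion : MeasurableSet slopeRegion := by
  have : slopeRegion = {p : ℝ × ℝ | 0 < p.1} ∩
      ({p | |p.2| ≤ 1 / 2} ∩ {p | p.1 ^ 4 * (1 - p.2 ^ 2) ≤ 1}) := rfl
  rw [this]
  exact (measurableSet_lt (by fun_prop) (by fun_prop)).inter
    ((measurableSet_le (by fun_prop) (by fun_prop)).inter
      (measurableSet_le (by fun_prop) (by fun_prop)))

theorem mul_mem_Dset_iff {x u : ℝ} (hx : 0 < x) :
    (x, x * u) ∈ Dset ↔ (x, u) ∈ slopeRegion := by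
  rw [mem_Dset_iff]
  simp only [slopeRegion, Set.mem_ofPred_eq, abs_mul, abs_of_pos hx]
  refine and_congr_right fun _ => and_congr ?_ ?_
  · rw [div_eq_mul_one_div, mul_le_mul_iff_right₀ hx]
  · have h : x ^ 2 - (x ^ 2)⁻¹ = (x ^ 4 - 1) / x ^ 2 := by field_simp
    rw [h, div_le_iff₀ (by positivity)]
    constructor <;> intro h <;> linarith [show (x * u) ^ 2 * x ^ 2 = x ^ 4 * u ^ 2 by ring]

theorem volume_Dset : volume Dset = ENNReal.ofReal (π / 6) := by
  have hslice (x : ℝ) : volume (Prod.mk x ⁻¹' Dset) =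
      ∫⁻ u, slopeRegion.indicator (fun p => ENNReal.ofReal p.1) (x, u) := by
    rcases le_or_gt x 0 with hx | hx
    · have h1 : Prod.mk x ⁻¹' Dset = ∅ :=
        Set.eq_empty_of_forall_notMem fun y hy => (hx.trans_lt hy.1).false
      have h2 (u : ℝ) : slopeRegion.indicator (fun p => ENNReal.ofReal p.1) (x, u) = 0 :=
        Set.indicator_of_notMem (fun h => (hx.trans_lt h.1).false) _
      simp [h1, h2]
    · have h1 := Real.volume_preimage_mul_left hx.ne' (Prod.mk x ⁻¹' Dset)
      have h2 : (fun u => x * u) ⁻¹' (Prod.mk x ⁻¹' Dset) = Prod.mk x ⁻¹' slopeRegion := by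
        ext u
        exact mul_mem_Dset_iff hx
      have h3 : (fun u => slopeRegion.indicator (fun p => ENNReal.ofReal p.1) (x, u)) =
          (Prod.mk x ⁻¹' slopeRegion).indicator (fun _ => ENNReal.ofReal x) := rfl
      rw [h3, lintegral_indicator (measurable_prodMk_left measurableSet_slopeRegion),
        setLIntegral_const, ← h2, h1, abs_of_pos (inv_pos.2 hx), ← mul_assoc,
        ← ENNReal.ofReal_mul hx.le, mul_inv_cancel₀ hx.ne', ENNReal.ofReal_one, one_mul]
  have hinner (u : ℝ) : ∫⁻ x, slopeRegion.indicator (fun p => ENNReal.ofReal p.1) (x, u) =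
      (Set.Icc (-(1 / 2) : ℝ) (1 / 2)).indicator
        (fun u => ENNReal.ofReal (1 / 2 * (1 / √(1 - u ^ 2)))) u := by
    by_cases hu : |u| ≤ 1 / 2
    · rw [Set.indicator_of_mem (Set.mem_Icc.2 (abs_le.1 hu))]
      have hu2 : 0 < 1 - u ^ 2 := by nlinarith [abs_le.1 hu]
      have hr := Real.sqrt_pos.2 hu2
      have hrs := Real.sq_sqrt hu2.le
      set r := √(1 - u ^ 2)
      have h3 : (fun x => slopeRegion.indicator (fun p => ENNReal.ofReal p.1) (x, u)) =
          ((fun x => (x, u)) ⁻¹' slopeRegion).indicator (fun x => ENNReal.ofReal x) := rfl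
      have hmeas : MeasurableSet ((fun x => (x, u)) ⁻¹' slopeRegion) :=
        measurable_prodMk_right measurableSet_slopeRegion
      rw [h3, lintegral_indicator hmeas,
        lintegral_ofReal_deriv_eq_volume_image (f := fun x => x ^ 2 / 2) hmeas
          (fun x _ => by simpa using (hasDerivAt_pow 2 x).div_const 2)
          (fun x hx => hx.1.le)
          (fun x hx y hy hxy => by
            have : x ^ 2 = y ^ 2 := by simpa using hxy
            exact (pow_left_inj₀ hx.1.le hy.1.le two_ne_zero).1 this)]
      have himg : (fun x => x ^ 2 / 2) '' ((fun x => (x, u)) ⁻¹' slopeRegion) =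
          Set.Ioc 0 (1 / 2 * (1 / r)) := by
        ext t
        simp only [Set.mem_image, Set.mem_preimage, slopeRegion, Set.mem_ofPred_eq, Set.mem_Ioc]
        constructor
        · rintro ⟨x, ⟨hx, -, hx4⟩, rfl⟩
          refine ⟨by positivity, ?_⟩
          rw [← hrs] at hx4
          have : x ^ 2 * r ≤ 1 := by
            refine (sq_le_one_iff₀ (by positivity)).1 ?_
            linarith [show (x ^ 2 * r) ^ 2 = x ^ 4 * r ^ 2 by ring]
          rw [← le_div_iff₀ hr] at this
          linarith
        · rintro ⟨ht, htr⟩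
          have h2 : √(2 * t) ^ 2 = 2 * t := Real.sq_sqrt (by positivity)
          refine ⟨√(2 * t), ⟨Real.sqrt_pos.2 (by positivity), hu, ?_⟩, ?_⟩
          · have h5 : 2 * t * r ≤ 1 := by
              rw [← le_div_iff₀ hr]
              linarith
            calc √(2 * t) ^ 4 * (1 - u ^ 2) = (2 * t * r) ^ 2 := by
                  rw [← hrs, show √(2 * t) ^ 4 = (√(2 * t) ^ 2) ^ 2 by ring, h2]; ring
              _ ≤ 1 := pow_le_one₀ (by positivity) h5
          · simp only [h2]; ring
      rw [himg, Real.volume_Ioc, sub_zero]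
    · rw [Set.indicator_of_notMem (fun h => hu (abs_le.2 (Set.mem_Icc.1 h)))]
      have h2 (x : ℝ) : slopeRegion.indicator (fun p => ENNReal.ofReal p.1) (x, u) = 0 :=
        Set.indicator_of_notMem (fun h => hu h.2.1) _
      simp [h2]
  have hsin : Real.sin (π / 6) = 1 / 2 := Real.sin_pi_div_six
  have hpi := Real.pi_pos
  have himg : (fun u => 1 / 2 * Real.arcsin u) '' Set.Icc (-(1 / 2)) (1 / 2) =
      Set.Icc (-(π / 12)) (π / 12) := by
    ext t
    simp only [Set.mem_image, Set.mem_Icc]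
    have harc : Real.arcsin (1 / 2) = π / 6 := by
      rw [← hsin, Real.arcsin_sin] <;> linarith
    constructor
    · rintro ⟨u, ⟨h1, h2⟩, rfl⟩
      have h3 := Real.monotone_arcsin h1
      have h4 := Real.monotone_arcsin h2
      rw [Real.arcsin_neg, harc] at h3
      rw [harc] at h4
      constructor <;> linarith
    · rintro ⟨h1, h2⟩
      refine ⟨Real.sin (2 * t), ⟨?_, ?_⟩, ?_⟩
      · rw [← hsin, ← Real.sin_neg]
        apply Real.sin_le_sin_of_le_of_le_pi_div_two <;> linarith
      · rw [← hsin]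
        apply Real.sin_le_sin_of_le_of_le_pi_div_two <;> linarith
      · rw [Real.arcsin_sin] <;> linarith
  rw [Measure.volume_eq_prod, Measure.prod_apply measurableSet_Dset, lintegral_congr hslice,
    lintegral_lintegral_swap
      (f := fun x u => slopeRegion.indicator (fun p => ENNReal.ofReal p.1) (x, u))
      ((by fun_prop : Measurable fun p : ℝ × ℝ => ENNReal.ofReal p.1).indicator
        measurableSet_slopeRegion).aemeasurable,
    lintegral_congr hinner, lintegral_indicator measurableSet_Icc,
    lintegral_ofReal_deriv_eq_volume_image (f := fun u => 1 / 2 * Real.arcsin u)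
      measurableSet_Icc
      (fun u hu => (Real.hasDerivAt_arcsin (by linarith [hu.1]) (by linarith [hu.2])).const_mul _)
      (fun u _ => by positivity)
      (fun u hu v hv huv => Real.injOn_arcsin ⟨by linarith [hu.1], by linarith [hu.2]⟩
        ⟨by linarith [hv.1], by linarith [hv.2]⟩ (by simpa using huv)),
    himg, Real.volume_Icc]
  congr 1
  ring

/-- The length of the second basis vector. -/
noncomputable def secondLength (p : ℝ × ℝ) : ℝ := √(p.2 ^ 2 + (p.1 ^ 2)⁻¹)

theorem measurable_secondLength : Measurable secondLength := by
  unfold secondLength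
  fun_prop

/-- The upper half `Dset ∩ {y > 0}` in the coordinates `x` and `s = √(y² + x⁻²)`. -/
def lengthRegion : Set (ℝ × ℝ) :=
  {p | 0 < p.1 ∧ 1 < p.1 * p.2 ∧ p.2 ^ 2 - (p.1 ^ 2)⁻¹ ≤ (p.1 / 2) ^ 2 ∧ p.1 ≤ p.2}

theorem measurableSet_lengthRegion : MeasurableSet lengthRegion := by
  have : lengthRegion = {p : ℝ × ℝ | 0 < p.1} ∩ ({p | 1 < p.1 * p.2} ∩
      ({p | p.2 ^ 2 - (p.1 ^ 2)⁻¹ ≤ (p.1 / 2) ^ 2} ∩ {p | p.1 ≤ p.2})) := rfl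
  rw [this]
  exact (measurableSet_lt (by fun_prop) (by fun_prop)).inter
    ((measurableSet_lt (by fun_prop) (by fun_prop)).inter
      ((measurableSet_le (by fun_prop) (by fun_prop)).inter
        (measurableSet_le (by fun_prop) (by fun_prop))))

theorem sq_sub_inv_sq_pos {x s : ℝ} (hx : 0 < x) (hxs : 1 < x * s) : 0 < s ^ 2 - (x ^ 2)⁻¹ := by
  have h : s ^ 2 - (x ^ 2)⁻¹ = ((x * s) ^ 2 - 1) / x ^ 2 := by field_simp
  have h1 : 1 < (x * s) ^ 2 := one_lt_pow₀ hxs two_ne_zero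
  rw [h]
  exact div_pos (by linarith) (by positivity)

/-- The Jacobian factor `∂y/∂s` of the change of variables `s = √(y² + x⁻²)` at fixed `x`. -/
noncomputable def lengthJacobian (p : ℝ × ℝ) : ℝ := p.2 / √(p.2 ^ 2 - (p.1 ^ 2)⁻¹)

theorem volume_inter_Ioi_zero {x : ℝ} (hx : 0 < x) {A : Set ℝ} (hA : MeasurableSet A) :
    volume ({y | (x, y) ∈ Dset ∧ secondLength (x, y) ∈ A} ∩ Set.Ioi 0) =
      ∫⁻ s in A ∩ Prod.mk x ⁻¹' lengthRegion, ENNReal.ofReal (lengthJacobian (x, s)) := by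
  have hpos {s : ℝ} (hs : s ∈ Prod.mk x ⁻¹' lengthRegion) : 0 < s := hx.trans_le hs.2.2.2
  rw [lintegral_ofReal_deriv_eq_volume_image (f := fun s => √(s ^ 2 - (x ^ 2)⁻¹))
    (hA.inter (measurable_prodMk_left measurableSet_lengthRegion))]
  · congr 1
    ext y
    simp only [Set.mem_inter_iff, Set.mem_ofPred_eq, Set.mem_Ioi, Set.mem_image,
      Set.mem_preimage, mem_Dset_iff, lengthRegion, secondLength]
    have hinv : 0 < (x ^ 2)⁻¹ := by positivity
    constructor
    · rintro ⟨⟨⟨-, h1, h2⟩, h3⟩, hy⟩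
      have hsq : √(y ^ 2 + (x ^ 2)⁻¹) ^ 2 = y ^ 2 + (x ^ 2)⁻¹ := Real.sq_sqrt (by positivity)
      refine ⟨_, ⟨h3, hx, ?_, ?_, ?_⟩, ?_⟩
      · refine (one_lt_sq_iff₀ (by positivity)).1 ?_
        have : x ^ 2 * (x ^ 2)⁻¹ = 1 := mul_inv_cancel₀ (by positivity)
        rw [mul_pow, hsq, mul_add, this]
        have : 0 < x ^ 2 * y ^ 2 := by positivity
        linarith
      · rw [hsq, add_sub_cancel_right]
        exact pow_le_pow_left₀ hy.le (abs_of_pos hy ▸ h1) 2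
      · exact Real.le_sqrt_of_sq_le (by linarith)
      · rw [hsq, add_sub_cancel_right, Real.sqrt_sq hy.le]
    · rintro ⟨s, ⟨hsA, -, h1, h2, h3⟩, rfl⟩
      have hp := sq_sub_inv_sq_pos hx h1
      have hsq := Real.sq_sqrt hp.le
      refine ⟨⟨⟨hx, ?_, ?_⟩, ?_⟩, Real.sqrt_pos.2 hp⟩
      · rw [abs_of_nonneg (Real.sqrt_nonneg _)]
        exact Real.sqrt_le_iff.2 ⟨by positivity, h2⟩
      · rw [hsq]
        have : x ^ 2 ≤ s ^ 2 := pow_le_pow_left₀ hx.le h3 2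
        linarith
      · rwa [hsq, sub_add_cancel, Real.sqrt_sq (hx.trans_le h3).le]
  · rintro s ⟨-, hs⟩
    have hp := sq_sub_inv_sq_pos hx hs.2.1
    refine (((hasDerivAt_pow 2 s).sub_const (x ^ 2)⁻¹).sqrt hp.ne').congr_deriv ?_
    simp only [lengthJacobian, Nat.cast_ofNat, Nat.add_one_sub_one, pow_one]
    exact mul_div_mul_left _ _ two_ne_zero
  · rintro s ⟨-, hs⟩
    have := hpos hs
    unfold lengthJacobian
    positivity
  · rintro s ⟨-, hs⟩ t ⟨-, ht⟩ hst
    have h := (Real.sqrt_inj (sq_sub_inv_sq_pos hx hs.2.1).le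
      (sq_sub_inv_sq_pos hx ht.2.1).le).1 hst
    exact (pow_left_inj₀ (hpos hs).le (hpos ht).le two_ne_zero).1 (by linarith)

theorem volume_eq_two_mul_inter_Ioi_zero {S : Set ℝ}
    (hneg : Neg.neg ⁻¹' S = S) : volume S = 2 * volume (S ∩ Set.Ioi 0) := by
  have h1 : volume (S ∩ Set.Iio 0) = volume (S ∩ Set.Ioi 0) := by
    rw [← Measure.measure_preimage_neg volume (S ∩ Set.Ioi 0), Set.preimage_inter, hneg]
    simp
  have h2 : volume (S \ Set.Ioi 0) = volume (S ∩ Set.Iio 0) := by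
    rw [Set.sdiff_eq, Set.compl_Ioi]
    exact measure_congr ((ae_eq_refl S).inter Iio_ae_eq_Iic.symm)
  rw [← measure_inter_add_sdiff S measurableSet_Ioi, h2, h1, two_mul]

theorem volume_inter_preimage_secondLength {A : Set ℝ} (hA : MeasurableSet A) :
    volume (secondLength ⁻¹' A ∩ Dset) =
      ∫⁻ s in A, 2 * ∫⁻ x in (fun x => (x, s)) ⁻¹' lengthRegion,
        ENNReal.ofReal (lengthJacobian (x, s)) := by
  set J : ℝ × ℝ → ENNReal :=
    (lengthRegion ∩ Prod.snd ⁻¹' A).indicator fun p => ENNReal.ofReal (lengthJacobian p) with hJ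
  have hSmeas : MeasurableSet (secondLength ⁻¹' A ∩ Dset) :=
    (measurable_secondLength hA).inter measurableSet_Dset
  have hRmeas : MeasurableSet (lengthRegion ∩ Prod.snd ⁻¹' A) :=
    measurableSet_lengthRegion.inter (measurable_snd hA)
  have hJmeas : Measurable J := by
    refine Measurable.indicator ?_ hRmeas
    unfold lengthJacobian
    fun_prop
  have hslice (x : ℝ) : volume (Prod.mk x ⁻¹' (secondLength ⁻¹' A ∩ Dset)) =
      2 * ∫⁻ s, J (x, s) := by
    rcases le_or_gt x 0 with hx | hx
    · have h1 : Prod.mk x ⁻¹' (secondLength ⁻¹' A ∩ Dset) = ∅ :=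
        Set.eq_empty_of_forall_notMem fun y hy => (hx.trans_lt hy.2.1).false
      have h2 (s : ℝ) : J (x, s) = 0 :=
        Set.indicator_of_notMem (fun h => (hx.trans_lt h.1.1).false) _
      simp [h1, h2]
    · have h1 : Prod.mk x ⁻¹' (secondLength ⁻¹' A ∩ Dset) =
          {y | (x, y) ∈ Dset ∧ secondLength (x, y) ∈ A} := Set.ext fun y => and_comm
      have h3 : (fun s => J (x, s)) = (A ∩ Prod.mk x ⁻¹' lengthRegion).indicator
          fun s => ENNReal.ofReal (lengthJacobian (x, s)) := by
        rw [Set.inter_comm]; rfl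
      rw [h1, volume_eq_two_mul_inter_Ioi_zero,
        volume_inter_Ioi_zero hx hA, h3, lintegral_indicator
          (hA.inter (measurable_prodMk_left measurableSet_lengthRegion))]
      ext y
      simp [mem_Dset_iff, secondLength]
  have hJs (s : ℝ) : 2 * ∫⁻ x, J (x, s) = A.indicator (fun s => 2 *
      ∫⁻ x in (fun x => (x, s)) ⁻¹' lengthRegion, ENNReal.ofReal (lengthJacobian (x, s))) s := by
    by_cases hs : s ∈ A
    · rw [Set.indicator_of_mem hs,
        ← lintegral_indicator (measurable_prodMk_right measurableSet_lengthRegion)]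
      congr 2
      ext x
      by_cases h : (x, s) ∈ lengthRegion <;> simp [hJ, Set.indicator, h, hs]
    · simp [hJ, Set.indicator, hs]
  have hswap := lintegral_lintegral_swap (f := fun x s => J (x, s)) (μ := volume) (ν := volume)
    hJmeas.aemeasurable
  rw [Measure.volume_eq_prod, Measure.prod_apply hSmeas, lintegral_congr hslice,
    lintegral_const_mul _ hJmeas.lintegral_prod_right', hswap,
    ← lintegral_const_mul _ hJmeas.lintegral_prod_left', lintegral_congr hJs,
    lintegral_indicator hA]

theorem setLIntegral_lengthJacobian {s X : ℝ} (hs : 0 < s) (hX : 0 < X) :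
    ∫⁻ x in Set.Ioc s⁻¹ X, ENNReal.ofReal (lengthJacobian (x, s)) =
      ENNReal.ofReal (√(X ^ 2 * s ^ 2 - 1) / s) := by
  have hmem {x : ℝ} (hx : x ∈ Set.Ioc s⁻¹ X) : 0 < x ∧ 0 < x ^ 2 * s ^ 2 - 1 := by
    have h0 : 0 < x := (inv_pos.2 hs).trans hx.1
    have h1 : 1 < x * s := (inv_lt_iff_one_lt_mul₀ hs).1 hx.1
    have h2 : 1 < (x * s) ^ 2 := one_lt_pow₀ h1 two_ne_zero
    exact ⟨h0, by linarith [mul_pow x s 2]⟩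
  rw [lintegral_ofReal_deriv_eq_volume_image (f := fun x => √(x ^ 2 * s ^ 2 - 1) / s)
    measurableSet_Ioc]
  · have himg : (fun x => √(x ^ 2 * s ^ 2 - 1) / s) '' Set.Ioc s⁻¹ X =
        Set.Ioc 0 (√(X ^ 2 * s ^ 2 - 1) / s) := by
      ext t
      simp only [Set.mem_image]
      constructor
      · rintro ⟨x, hx, rfl⟩
        obtain ⟨h0, h1⟩ := hmem hx
        refine ⟨div_pos (Real.sqrt_pos.2 h1) hs, ?_⟩
        have := hx.2
        gcongr
      · rintro ⟨ht, htX⟩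
        have hq : √((t * s) ^ 2 + 1) ^ 2 = (t * s) ^ 2 + 1 := Real.sq_sqrt (by positivity)
        refine ⟨√((t * s) ^ 2 + 1) / s, ⟨?_, ?_⟩, ?_⟩
        · rw [inv_eq_one_div]
          gcongr
          rw [Real.lt_sqrt zero_le_one]
          nlinarith [mul_pos ht hs]
        · rw [div_le_iff₀ hs, Real.sqrt_le_iff]
          rw [le_div_iff₀ hs, Real.le_sqrt' (mul_pos ht hs)] at htX
          exact ⟨by positivity, by linarith [mul_pow X s 2]⟩
        · rw [div_pow, hq, div_mul_cancel₀ _ (by positivity), add_sub_cancel_right,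
            Real.sqrt_sq (by positivity), mul_div_cancel_right₀ _ hs.ne']
    rw [himg, Real.volume_Ioc, sub_zero]
  · intro x hx
    obtain ⟨h0, h1⟩ := hmem hx
    refine (((((hasDerivAt_pow 2 x).mul_const (s ^ 2)).sub_const 1).sqrt h1.ne').div_const
      s).congr_deriv ?_
    have h2 : s ^ 2 - (x ^ 2)⁻¹ = (x ^ 2 * s ^ 2 - 1) / x ^ 2 := by field_simp
    have h3 := (Real.sqrt_pos.2 h1).ne'
    simp only [lengthJacobian]
    rw [h2, Real.sqrt_div h1.le, Real.sqrt_sq h0.le]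
    field_simp
    simp
  · intro x _
    unfold lengthJacobian
    positivity
  · intro x hx y hy hxy
    obtain ⟨hx0, hx1⟩ := hmem hx
    obtain ⟨hy0, hy1⟩ := hmem hy
    have h := (Real.sqrt_inj hx1.le hy1.le).1 ((div_left_inj' hs.ne').1 hxy)
    have h' : x ^ 2 = y ^ 2 := mul_right_cancel₀ (pow_pos hs 2).ne' (by linarith)
    exact (pow_left_inj₀ hx0.le hy0.le two_ne_zero).1 h'

theorem mem_lengthRegion_iff {x s : ℝ} (hs : 1 < s) :
    (x, s) ∈ lengthRegion ↔
      s⁻¹ < x ∧ x ^ 2 ≤ s ^ 2 ∧ x ^ 2 ≤ 2 * (s ^ 2 - √(s ^ 4 - 1)) := by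
  have hs0 : 0 < s := by linarith
  have hr0 := Real.sqrt_nonneg (s ^ 4 - 1)
  have hr : √(s ^ 4 - 1) ^ 2 = s ^ 4 - 1 :=
    Real.sq_sqrt (by linarith [one_lt_pow₀ hs four_ne_zero])
  set r := √(s ^ 4 - 1)
  have hiff {x : ℝ} (hx : 0 < x) : s ^ 2 - (x ^ 2)⁻¹ ≤ (x / 2) ^ 2 ↔
      (2 * r) ^ 2 ≤ (2 * s ^ 2 - x ^ 2) ^ 2 := by
    have h : s ^ 2 - (x ^ 2)⁻¹ = (x ^ 2 * s ^ 2 - 1) / x ^ 2 := by field_simp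
    rw [h, div_le_iff₀ (by positivity)]
    constructor <;> intro h <;> nlinarith
  simp only [lengthRegion, Set.mem_ofPred_eq]
  rw [← inv_lt_iff_one_lt_mul₀ hs0]
  constructor
  · rintro ⟨hx, h1, h2, h3⟩
    have h4 : x ^ 2 ≤ s ^ 2 := pow_le_pow_left₀ hx.le h3 2
    refine ⟨h1, h4, ?_⟩
    have := (pow_le_pow_iff_left₀ (by positivity) (by nlinarith) two_ne_zero).1 ((hiff hx).1 h2)
    linarith
  · rintro ⟨h1, h2, h3⟩
    have hx : 0 < x := (inv_pos.2 hs0).trans h1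
    refine ⟨hx, h1, (hiff hx).2 ?_, (pow_le_pow_iff_left₀ hx.le hs0.le two_ne_zero).1 h2⟩
    exact pow_le_pow_left₀ (by positivity) (by linarith) 2

theorem four_thirds_rpow_pow_four : ((4 / 3 : ℝ) ^ ((1 : ℝ) / 4)) ^ 4 = 4 / 3 := by
  rw [← Real.rpow_natCast, ← Real.rpow_mul (by norm_num)]
  norm_num

theorem setLIntegral_lengthJacobian_of_lt {s : ℝ} (hs : 1 < s)
    (hs' : s < (4 / 3 : ℝ) ^ ((1 : ℝ) / 4)) :
    ∫⁻ x in (fun x => (x, s)) ⁻¹' lengthRegion, ENNReal.ofReal (lengthJacobian (x, s)) =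
      ENNReal.ofReal (√(s ^ 4 - 1) / s) := by
  have hs0 : 0 < s := by linarith
  have hs4 : s ^ 4 < 4 / 3 := by
    rw [← four_thirds_rpow_pow_four]
    exact pow_lt_pow_left₀ hs' hs0.le four_ne_zero
  have hr : 2 * √(s ^ 4 - 1) ≤ s ^ 2 := by
    have := Real.sqrt_le_iff.2 (⟨by positivity, by nlinarith⟩ :
      0 ≤ s ^ 2 / 2 ∧ s ^ 4 - 1 ≤ (s ^ 2 / 2) ^ 2)
    linarith
  have hset : (fun x => (x, s)) ⁻¹' lengthRegion = Set.Ioc s⁻¹ s := by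
    ext x
    rw [Set.mem_preimage, mem_lengthRegion_iff hs, Set.mem_Ioc]
    refine and_congr_right fun hx => ?_
    have hx0 : 0 < x := (inv_pos.2 hs0).trans hx
    rw [← pow_le_pow_iff_left₀ hx0.le hs0.le two_ne_zero]
    exact ⟨fun h => h.1, fun h => ⟨h, by linarith⟩⟩
  rw [hset, setLIntegral_lengthJacobian hs0 hs0, ← pow_add]

theorem setLIntegral_lengthJacobian_of_gt {s : ℝ} (hs : (4 / 3 : ℝ) ^ ((1 : ℝ) / 4) < s) :
    ∫⁻ x in (fun x => (x, s)) ⁻¹' lengthRegion, ENNReal.ofReal (lengthJacobian (x, s)) =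
      ENNReal.ofReal (√(2 * s ^ 2 * (s ^ 2 - √(s ^ 4 - 1)) - 1) / s) := by
  have hs1 : 1 < s := (Real.one_lt_rpow (by norm_num) (by norm_num)).trans hs
  have hs0 : 0 < s := by linarith
  have hs4 : 4 / 3 < s ^ 4 := by
    rw [← four_thirds_rpow_pow_four]
    exact pow_lt_pow_left₀ hs (by positivity) four_ne_zero
  have hr : s ^ 2 ≤ 2 * √(s ^ 4 - 1) := by
    have := Real.le_sqrt_of_sq_le (by nlinarith : (s ^ 2 / 2) ^ 2 ≤ s ^ 4 - 1)
    linarith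
  have hr' : √(s ^ 4 - 1) < s ^ 2 := by
    rw [Real.sqrt_lt' (by positivity)]
    linarith [pow_mul s 2 2]
  have hX := Real.sqrt_pos.2 (show 0 < 2 * (s ^ 2 - √(s ^ 4 - 1)) by linarith)
  have hX2 := Real.sq_sqrt (show 0 ≤ 2 * (s ^ 2 - √(s ^ 4 - 1)) by linarith)
  have hset : (fun x => (x, s)) ⁻¹' lengthRegion =
      Set.Ioc s⁻¹ √(2 * (s ^ 2 - √(s ^ 4 - 1))) := by
    ext x
    rw [Set.mem_preimage, mem_lengthRegion_iff hs1, Set.mem_Ioc]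
    refine and_congr_right fun hx => ?_
    have hx0 : 0 < x := (inv_pos.2 hs0).trans hx
    rw [← pow_le_pow_iff_left₀ hx0.le hX.le two_ne_zero, hX2]
    exact ⟨fun h => h.2, fun h => ⟨by linarith, h⟩⟩
  rw [hset, setLIntegral_lengthJacobian hs0 hX, hX2]
  congr 4
  ring

theorem lengthRegion_slice_of_le_one {s : ℝ} (hs : s ≤ 1) :
    (fun x => (x, s)) ⁻¹' lengthRegion = ∅ := by
  refine Set.eq_empty_of_forall_notMem fun x ⟨hx, h1, _, h3⟩ => ?_
  dsimp only at hx h1 h3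
  nlinarith

theorem stmt16 :
    Measure.map (fun p : ℝ × ℝ => Real.sqrt (p.2 ^ 2 + (p.1 ^ 2)⁻¹)) μD =
      volume.withDensity (fun s : ℝ =>
        ENNReal.ofReal
          ((if 1 < s ∧ s < (4 / 3 : ℝ) ^ ((1 : ℝ) / 4) then
              (12 / (π * s)) * Real.sqrt (s ^ 4 - 1)
            else 0) +
          (if (4 / 3 : ℝ) ^ ((1 : ℝ) / 4) < s then
              (12 / (π * s)) *
                Real.sqrt (2 * s ^ 2 * (s ^ 2 - Real.sqrt (s ^ 4 - 1)) - 1)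
            else 0))) := by
  have hvol : volume Dset ≠ 0 ∧ volume Dset ≠ ⊤ := by
    rw [volume_Dset]
    exact ⟨(ENNReal.ofReal_pos.2 (by positivity)).ne', ENNReal.ofReal_ne_top⟩
  ext A hA
  change Measure.map secondLength μD A = _
  rw [Measure.map_apply measurable_secondLength hA, withDensity_apply _ hA, μD,
    Measure.smul_apply, Measure.restrict_apply (measurable_secondLength hA), smul_eq_mul,
    volume_inter_preimage_secondLength hA, mul_comm, ← div_eq_mul_inv,
    eq_comm, ENNReal.eq_div_iff hvol.1 hvol.2, volume_Dset, eq_comm,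
    ← lintegral_const_mul' _ _ ENNReal.ofReal_ne_top]
  refine lintegral_congr_ae (ae_restrict_of_ae ?_)
  filter_upwards [compl_mem_ae_iff.2 (measure_singleton ((4 / 3 : ℝ) ^ ((1 : ℝ) / 4)))] with s hsc
  have hc1 : 1 < (4 / 3 : ℝ) ^ ((1 : ℝ) / 4) := Real.one_lt_rpow (by norm_num) (by norm_num)
  have hscale (w : ℝ) : 2 * ENNReal.ofReal (w / s) =
      ENNReal.ofReal (π / 6) * ENNReal.ofReal (12 / (π * s) * w) := by
    rw [← ENNReal.ofReal_mul (by positivity), ← ENNReal.ofReal_ofNat 2,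
      ← ENNReal.ofReal_mul zero_le_two]
    congr 1
    field_simp
    ring
  rcases le_or_gt s 1 with hs | hs
  · rw [lengthRegion_slice_of_le_one hs, if_neg fun h => hs.not_gt h.1,
      if_neg (hs.trans hc1.le).not_gt]
    simp
  rcases lt_or_gt_of_ne hsc with h | h
  · rw [if_pos ⟨hs, h⟩, if_neg h.not_gt, add_zero, setLIntegral_lengthJacobian_of_lt hs h, hscale]
  · rw [if_neg fun h' => h.not_gt h'.2, if_pos h, zero_add, setLIntegral_lengthJacobian_of_gt h,
      hscale]
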